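/- For every γ ∈ N^n there exist k ∈ N and polynomials f_1,…,f_k, g_1,…,g_k ∈ C[t_1,…,t_n] such that for all α ∈ N^n, Σ_{i=1}^k f_i · ∂^α(g_i) equals 1 if α = γ and equals 0 if α ≠ γ, where ∂^α = (∂/∂t_1)^{α_1}⋯(∂/∂t_n)^{α_n}. -/

import Mathlib

/-!
STATEMENT 13: For every γ ∈ ℕ^n there exist k ∈ ℕ and polynomials f_1,…,f_k, g_1,…,g_k in
ℂ[t_1,…,t_n] such that for all α ∈ ℕ^n, Σ_{i=1}^k f_i · ∂^α(g_i) equals 1 if α = γ and 0 otherwise.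
-/

open MvPolynomial

noncomputable section

/-- The composite partial derivative operator `∂^α = (∂/∂t_1)^{α_1} ⋯ (∂/∂t_n)^{α_n}`
on `ℂ[t_1,…,t_n]`. -/
def pdPow (n : ℕ) (α : Fin n → ℕ) : Module.End ℂ (MvPolynomial (Fin n) ℂ) :=
  (List.ofFn fun i : Fin n =>
    (((pderiv i : Derivation ℂ (MvPolynomial (Fin n) ℂ) (MvPolynomial (Fin n) ℂ)).toLinearMap :
        Module.End ℂ (MvPolynomial (Fin n) ℂ)) ^ (α i))).prod

/-- The partial derivative with respect to `t_i`, as a linear endomorphism. -/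
abbrev pderivEnd {n : ℕ} (i : Fin n) : Module.End ℂ (MvPolynomial (Fin n) ℂ) :=
  (pderiv i : Derivation ℂ (MvPolynomial (Fin n) ℂ) (MvPolynomial (Fin n) ℂ)).toLinearMap

/-- The divided power `p ^ q / q!`. -/
def dividedPow {n : ℕ} (p : MvPolynomial (Fin n) ℂ) (q : ℕ) : MvPolynomial (Fin n) ℂ :=
  C ((q.factorial : ℂ)⁻¹) * p ^ q

lemma dividedPow_zero {n : ℕ} (p : MvPolynomial (Fin n) ℂ) : dividedPow p 0 = 1 := by
  simp [dividedPow]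

lemma pderiv_dividedPow_X_succ {n : ℕ} (i : Fin n) (q : ℕ) :
    pderiv i (dividedPow (X i) (q + 1)) = dividedPow (X i) q := by
  have hq : (q : ℂ) + 1 ≠ 0 := by exact_mod_cast q.succ_ne_zero
  have h : ((q + 1).factorial : ℂ)⁻¹ * ((q : ℂ) + 1) = (q.factorial : ℂ)⁻¹ := by
    rw [Nat.factorial_succ]
    push_cast
    field_simp
  have hC : ((q : MvPolynomial (Fin n) ℂ) + 1) = C ((q : ℂ) + 1) := by simp
  rw [dividedPow, pderiv_C_mul, pderiv_pow, pderiv_X_self, dividedPow, ← h, C_mul]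
  push_cast
  rw [hC]
  ring

lemma pderiv_dividedPow_X_of_ne {n : ℕ} {i j : Fin n} (h : i ≠ j) (q : ℕ) :
    pderiv i (dividedPow (X j) q) = 0 := by
  rw [dividedPow, pderiv_C_mul, pderiv_pow, pderiv_X_of_ne h.symm]
  simp

lemma pderivEnd_pow_succ_dividedPow_zero {n : ℕ} (i : Fin n) (a : ℕ) :
    (pderivEnd i ^ (a + 1)) (dividedPow (X i) 0) = 0 := by
  simp [dividedPow_zero, pow_succ]

lemma pderivEnd_pow_succ_dividedPow_succ {n : ℕ} (i : Fin n) (a q : ℕ) :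
    (pderivEnd i ^ (a + 1)) (dividedPow (X i) (q + 1)) =
      (pderivEnd i ^ a) (dividedPow (X i) q) := by
  rw [pow_succ, Module.End.mul_apply]
  exact congrArg _ (pderiv_dividedPow_X_succ i q)

lemma pderiv_pderivEnd_pow_dividedPow_of_ne {n : ℕ} {i j : Fin n} (h : i ≠ j) (a q : ℕ) :
    pderiv i ((pderivEnd j ^ a) (dividedPow (X j) q)) = 0 := by
  induction a generalizing q with
  | zero => exact pderiv_dividedPow_X_of_ne h q
  | succ a ih =>
    cases q with
    | zero => rw [pderivEnd_pow_succ_dividedPow_zero, map_zero]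
    | succ q => rw [pderivEnd_pow_succ_dividedPow_succ, ih]

lemma pderivEnd_pow_mul {n : ℕ} {i : Fin n} {p : MvPolynomial (Fin n) ℂ} (hp : pderiv i p = 0)
    (a : ℕ) (q : MvPolynomial (Fin n) ℂ) :
    (pderivEnd i ^ a) (p * q) = p * (pderivEnd i ^ a) q := by
  induction a generalizing q with
  | zero => rfl
  | succ a ih =>
    have h : pderivEnd i (p * q) = p * pderivEnd i q := by simp [hp]
    rw [pow_succ, Module.End.mul_apply, Module.End.mul_apply, h, ih]

lemma Derivation.map_prod_eq_zero {R A ι : Type*} [CommSemiring R] [CommSemiring A] [Algebra R A]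
    (D : Derivation R A A) (s : Finset ι) (h : ι → A) (hD : ∀ j ∈ s, D (h j) = 0) :
    D (∏ j ∈ s, h j) = 0 := by
  classical
  induction s using Finset.induction_on with
  | empty => simp
  | insert j s hj ih =>
    rw [Finset.prod_insert hj, D.leibniz, hD j (by simp), ih fun k hk => hD k (by simp [hk])]
    simp

lemma list_prod_pderivEnd_pow_prod {n : ℕ} (α : Fin n → ℕ)
    (h : Fin n → MvPolynomial (Fin n) ℂ)
    (hh : ∀ i j, i ≠ j → ∀ a, pderiv i ((pderivEnd j ^ a) (h j)) = 0)
    (l : List (Fin n)) (hl : l.Nodup) :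
    (l.map fun i => pderivEnd i ^ α i).prod (∏ j, h j) =
      ∏ j, (pderivEnd j ^ (if j ∈ l then α j else 0)) (h j) := by
  induction l with
  | nil => simp
  | cons i l ih =>
    obtain ⟨hi, hl⟩ := List.nodup_cons.mp hl
    rw [List.map_cons, List.prod_cons, Module.End.mul_apply, ih hl,
      ← Finset.prod_erase_mul _ _ (Finset.mem_univ i),
      ← Finset.prod_erase_mul _ _ (Finset.mem_univ i), pderivEnd_pow_mul]
    · congr 1
      · refine Finset.prod_congr rfl fun j hj => ?_
        simp [Finset.ne_of_mem_erase hj]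
      · simp [hi]
    · exact Derivation.map_prod_eq_zero _ _ _ fun j hj => hh i j (Finset.ne_of_mem_erase hj).symm _

lemma pdPow_prod_dividedPow_X {n : ℕ} (α m : Fin n → ℕ) :
    pdPow n α (∏ j, dividedPow (X j) (m j)) =
      ∏ j, (pderivEnd j ^ α j) (dividedPow (X j) (m j)) := by
  rw [pdPow, List.ofFn_eq_map, list_prod_pderivEnd_pow_prod α _
    (fun i j hij a => pderiv_pderivEnd_pow_dividedPow_of_ne hij a _) _ (List.nodup_finRange n)]
  simp

lemma sum_antidiagonal_dividedPow_mul {n : ℕ} (p q : MvPolynomial (Fin n) ℂ) (c : ℕ) :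
    ∑ s ∈ Finset.HasAntidiagonal.antidiagonal c, dividedPow p s.1 * dividedPow q s.2 =
      dividedPow (p + q) c := by
  rw [dividedPow, (Commute.all p q).add_pow', Finset.mul_sum]
  refine Finset.sum_congr rfl fun s hs => ?_
  obtain rfl := Finset.HasAntidiagonal.mem_antidiagonal.mp hs
  have h : ((s.1 + s.2).factorial : ℂ)⁻¹ * ((s.1 + s.2).choose s.1 : ℂ) =
      (s.1.factorial : ℂ)⁻¹ * (s.2.factorial : ℂ)⁻¹ := by
    have h₁ : (s.1.factorial : ℂ) ≠ 0 := by exact_mod_cast s.1.factorial_ne_zero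
    have h₂ : (s.2.factorial : ℂ) ≠ 0 := by exact_mod_cast s.2.factorial_ne_zero
    have h₃ : ((s.1 + s.2).factorial : ℂ) ≠ 0 := by
      exact_mod_cast (s.1 + s.2).factorial_ne_zero
    rw [Nat.cast_add_choose]
    field_simp
  have hC := congrArg (C : ℂ → MvPolynomial (Fin n) ℂ) h
  rw [C_mul, C_mul, map_natCast] at hC
  rw [dividedPow, dividedPow, nsmul_eq_mul]
  linear_combination -(p ^ s.1 * q ^ s.2) * hC

lemma sum_antidiagonal_dividedPow_mul_pderivEnd_pow {n : ℕ} (i : Fin n) (c a : ℕ) :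
    ∑ s ∈ Finset.HasAntidiagonal.antidiagonal c,
      dividedPow (-X i) s.1 * (pderivEnd i ^ a) (dividedPow (X i) s.2) =
        if a = c then 1 else 0 := by
  induction a generalizing c with
  | zero =>
    simp only [pow_zero, Module.End.one_apply]
    rw [sum_antidiagonal_dividedPow_mul, neg_add_cancel]
    cases c <;> simp [dividedPow]
  | succ a ih =>
    cases c with
    | zero => simp [pderivEnd_pow_succ_dividedPow_zero]
    | succ c =>
      rw [Finset.Nat.sum_antidiagonal_succ', pderivEnd_pow_succ_dividedPow_zero]
      simp only [pderivEnd_pow_succ_dividedPow_succ]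
      rw [ih]
      simp

theorem exists_dual_family (n : ℕ) (γ : Fin n → ℕ) :
    ∃ (k : ℕ) (f g : Fin k → MvPolynomial (Fin n) ℂ),
      ∀ α : Fin n → ℕ,
        (∑ i, f i * pdPow n α (g i)) = if α = γ then 1 else 0 := by
  classical
  let S := Fintype.piFinset fun i => Finset.HasAntidiagonal.antidiagonal (γ i)
  let e : S ≃ Fin S.card := S.equivFin
  refine ⟨S.card, fun k => ∏ i, dividedPow (-X i) ((e.symm k).1 i).1,
    fun k => ∏ i, dividedPow (X i) ((e.symm k).1 i).2, fun α => ?_⟩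
  rw [e.symm.sum_comp fun s : S => (∏ i, dividedPow (-X i) (s.1 i).1) *
      pdPow n α (∏ i, dividedPow (X i) (s.1 i).2),
    Finset.sum_coe_sort S fun s => (∏ i, dividedPow (-X i) (s i).1) *
      pdPow n α (∏ i, dividedPow (X i) (s i).2)]
  simp only [pdPow_prod_dividedPow_X, ← Finset.prod_mul_distrib]
  rw [← Finset.prod_univ_sum (fun i => Finset.HasAntidiagonal.antidiagonal (γ i)) fun i s =>
    dividedPow (-X i) s.1 * (pderivEnd i ^ α i) (dividedPow (X i) s.2)]
  simp only [sum_antidiagonal_dividedPow_mul_pderivEnd_pow]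
  simp [Finset.prod_ite_zero, funext_iff]

end
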